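/- Let G be a finite connected simple graph and suppose the bicircular matroid M = B(G) is 3-connected. Let λ be a positive integer and let (U, V) be a partition of E(G) with λ_M(U) ≤ λ. Then the number of vertices of G that are incident both with an edge of U and with an edge of V is at most 14λ − 12. -/

import Mathlib

open Set

noncomputable def mrank {α : Type*} (M : Matroid α) (X : Set α) : ℕ :=
  sSup {n | ∃ I, I ⊆ X ∧ M.Indep I ∧ I.ncard = n}

noncomputable def connVal {α : Type*} (M : Matroid α) (U : Set α) : ℕ :=
  mrank M U + mrank M (M.E \ U) - mrank M M.E

def Sim {α : Type*} (M : Matroid α) (U X X' : Set α) : Prop :=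
  ∀ Z ⊆ M.E \ U, (M.Indep (X ∪ Z) ↔ M.Indep (X' ∪ Z))

def SimClassesLE {α : Type*} (M : Matroid α) (U : Set α) (k : ℕ) : Prop :=
  ∃ f : Set α → Fin k, ∀ X X' : Set α, X ⊆ U → X' ⊆ U → f X = f X' → Sim M U X X'

structure Decomp {α : Type*} (M : Matroid α) where
  V : Type
  fin : Finite V
  T : SimpleGraph V
  conn : T.Connected
  acyc : T.IsAcyclic
  deg : ∀ v : V, (T.neighborSet v).ncard = 1 ∨ (T.neighborSet v).ncard = 3
  leafEquiv : M.E ≃ {v : V // (T.neighborSet v).ncard = 1}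

def Decomp.Displays {α : Type*} {M : Matroid α} (D : Decomp M) (U : Set α) : Prop :=
  ∃ u v : D.V, D.T.Adj u v ∧
    U = {x | ∃ h : x ∈ M.E, (D.T.deleteEdges {s(u, v)}).Reachable (D.leafEquiv ⟨x, h⟩).1 u}

def bwLE {α : Type*} (M : Matroid α) (k : ℕ) : Prop :=
  ∃ D : Decomp M, ∀ U, D.Displays U → connVal M U + 1 ≤ k

def dwLE {α : Type*} (M : Matroid α) (k : ℕ) : Prop :=
  ∃ D : Decomp M, ∀ U, D.Displays U → SimClassesLE M U k

def Pigeonhole {α : Type*} (C : Set (Matroid α)) : Prop :=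
  ∀ l : ℕ, 0 < l → ∃ ρ : ℕ, ∀ M ∈ C, bwLE M l → dwLE M ρ

/-- The vertices incident with an edge of the edge set \`Y\`. -/
def edgeVerts {α : Type*} (Y : Set (Sym2 α)) : Set α := {x | ∃ e ∈ Y, x ∈ e}

/-- Two edges are connected within the edge set \`Y\`: joined by a sequence of edges of \`Y\`,
consecutive ones sharing a vertex. -/
def EdgeConn {α : Type*} (Y : Set (Sym2 α)) (e f : Sym2 α) : Prop :=
  Relation.ReflTransGen (fun a b => a ∈ Y ∧ b ∈ Y ∧ ∃ x, x ∈ a ∧ x ∈ b) e f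

/-- The connected component of the subgraph with edge set \`Y\` containing the edge \`e\`. -/
def edgeComponent {α : Type*} (Y : Set (Sym2 α)) (e : Sym2 α) : Set (Sym2 α) :=
  {f ∈ Y | EdgeConn Y e f}

/-- \`C\` is the edge set of a cycle: nonempty, connected, and every incident vertex lies
in exactly two of its edges. -/
def IsCycleSet {α : Type*} (C : Set (Sym2 α)) : Prop :=
  C.Nonempty ∧ (∀ e ∈ C, ∀ f ∈ C, EdgeConn C e f) ∧
    ∀ x ∈ edgeVerts C, ({e ∈ C | x ∈ e}).ncard = 2

/-- Independence in the bicircular matroid B(G): every connected component of the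
subgraph with edge set \`X\` contains at most one cycle. -/
def BicircIndep {α : Type*} (X : Set (Sym2 α)) : Prop :=
  ∀ e ∈ X, {C : Set (Sym2 α) | C ⊆ edgeComponent X e ∧ IsCycleSet C}.Subsingleton

/-- \`M\` is the bicircular matroid B(G). -/
def IsBicircular {α : Type*} (G : SimpleGraph α) (M : Matroid (Sym2 α)) : Prop :=
  M.E = G.edgeSet ∧ ∀ X ⊆ G.edgeSet, (M.Indep X ↔ BicircIndep X)

/-- \`M\` is 3-connected: it has no 1-separations and no 2-separations. -/
def ThreeConnected {α : Type*} (M : Matroid α) : Prop :=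
  ∀ U : Set α, U ⊆ M.E → ∀ k : ℕ, 0 < k → k < 3 →
    ¬(k ≤ U.ncard ∧ k ≤ (M.E \ U).ncard ∧ connVal M U < k)

section EdgeSets

variable {α : Type*} {X Y : Set (Sym2 α)}

lemma edgeVerts_mono (h : X ⊆ Y) : edgeVerts X ⊆ edgeVerts Y :=
  fun _ ⟨e, he, hx⟩ => ⟨e, h he, hx⟩

lemma edgeVerts_union (X Y : Set (Sym2 α)) :
    edgeVerts (X ∪ Y) = edgeVerts X ∪ edgeVerts Y := by
  ext x
  simp only [edgeVerts, mem_ofPred_eq, mem_union]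
  grind

lemma edgeVerts_inter_subset (X Y : Set (Sym2 α)) :
    edgeVerts (X ∩ Y) ⊆ edgeVerts X ∩ edgeVerts Y :=
  subset_inter (edgeVerts_mono inter_subset_left) (edgeVerts_mono inter_subset_right)

lemma EdgeConn.mono (h : X ⊆ Y) {e f : Sym2 α} (hef : EdgeConn X e f) : EdgeConn Y e f :=
  Relation.ReflTransGen.mono (fun _ _ ⟨ha, hb, hx⟩ => ⟨h ha, h hb, hx⟩) e f hef

lemma edgeComponent_subset (Y : Set (Sym2 α)) (e : Sym2 α) : edgeComponent Y e ⊆ Y :=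
  fun _ hf => hf.1

lemma disjoint_edgeVerts_edgeComponent (Y : Set (Sym2 α)) (e : Sym2 α) :
    Disjoint (edgeVerts (edgeComponent Y e)) (edgeVerts (Y \ edgeComponent Y e)) := by
  rw [Set.disjoint_left]
  rintro x ⟨f, hf, hxf⟩ ⟨g, hg, hxg⟩
  exact hg.2 ⟨hg.1, hf.2.tail ⟨hf.1, hg.1, x, hxf, hxg⟩⟩

lemma not_isDiag_of_subset_edgeSet {G : SimpleGraph α} (hX : X ⊆ G.edgeSet) :
    ∀ e ∈ X, ¬ e.IsDiag :=
  fun _ he => G.not_isDiag_of_mem_edgeSet (hX he)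

variable [Fintype α]

/-- Handshake lemma for a set of loopless edges. -/
lemma sum_ncard_incident (hY : ∀ e ∈ Y, ¬ e.IsDiag) :
    ∑ x : α, ({e ∈ Y | x ∈ e}).ncard = 2 * Y.ncard := by
  classical
  have h1 : ∀ x : α, ({e ∈ Y | x ∈ e}).ncard = ∑ e ∈ Y.toFinset, if x ∈ e then 1 else 0 := by
    intro x
    rw [Finset.sum_boole, ncard_eq_toFinset_card']
    simp only [Nat.cast_id]
    congr 1
    ext e
    simp
  simp_rw [h1]
  rw [Finset.sum_comm]
  have h2 : ∀ e ∈ Y.toFinset, (∑ x : α, if x ∈ e then 1 else 0) = 2 := by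
    intro e he
    rw [Finset.sum_boole, ← Sym2.card_toFinset_of_not_isDiag e (hY e (by simpa using he))]
    simp only [Nat.cast_id]
    congr 1
    ext x
    simp
  rw [Finset.sum_congr rfl h2, Finset.sum_const, ncard_eq_toFinset_card']
  simp [mul_comm]

lemma sum_ncard_incident_edgeVerts (hY : ∀ e ∈ Y, ¬ e.IsDiag) :
    ∑ x ∈ (edgeVerts Y).toFinite.toFinset, ({e ∈ Y | x ∈ e}).ncard = 2 * Y.ncard := by
  rw [← sum_ncard_incident hY]
  refine Finset.sum_subset (Finset.subset_univ _) fun x _ hx => ?_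
  rw [ncard_eq_zero]
  ext e
  simp only [Finite.mem_toFinset] at hx
  simp only [mem_ofPred_eq, mem_empty_iff_false, iff_false, not_and]
  exact fun he hxe => hx ⟨e, he, hxe⟩

/-- If the average degree is two and all degrees lie on one side of two, all are two. -/
lemma ncard_incident_eq_two_of_le (hY : ∀ e ∈ Y, ¬ e.IsDiag)
    (hcard : Y.ncard = (edgeVerts Y).ncard)
    (hdeg : ∀ x ∈ edgeVerts Y, ({e ∈ Y | x ∈ e}).ncard ≤ 2) :
    ∀ x ∈ edgeVerts Y, ({e ∈ Y | x ∈ e}).ncard = 2 := by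
  have h := (Finset.sum_eq_sum_iff_of_le (s := (edgeVerts Y).toFinite.toFinset)
    (f := fun x => ({e ∈ Y | x ∈ e}).ncard) (g := fun _ => 2)
    (fun x hx => hdeg x (by simpa using hx))).1 (by
      rw [sum_ncard_incident_edgeVerts hY, Finset.sum_const, ← ncard_eq_toFinset_card,
        smul_eq_mul, hcard, mul_comm])
  exact fun x hx => h x (by simpa using hx)

lemma ncard_incident_eq_two_of_ge (hY : ∀ e ∈ Y, ¬ e.IsDiag)
    (hcard : Y.ncard = (edgeVerts Y).ncard)
    (hdeg : ∀ x ∈ edgeVerts Y, 2 ≤ ({e ∈ Y | x ∈ e}).ncard) :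
    ∀ x ∈ edgeVerts Y, ({e ∈ Y | x ∈ e}).ncard = 2 := by
  have h := (Finset.sum_eq_sum_iff_of_le (s := (edgeVerts Y).toFinite.toFinset)
    (f := fun _ => 2) (g := fun x => ({e ∈ Y | x ∈ e}).ncard)
    (fun x hx => hdeg x (by simpa using hx))).1 (by
      rw [sum_ncard_incident_edgeVerts hY, Finset.sum_const, ← ncard_eq_toFinset_card,
        smul_eq_mul, hcard, mul_comm])
  exact fun x hx => (h x (by simpa using hx)).symm

lemma IsCycleSet.ncard_eq (hY : ∀ e ∈ Y, ¬ e.IsDiag) (hC : IsCycleSet Y) :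
    Y.ncard = (edgeVerts Y).ncard := by
  have h := sum_ncard_incident_edgeVerts hY
  rw [Finset.sum_congr rfl (fun x hx => hC.2.2 x (by simpa using hx)), Finset.sum_const,
    ← ncard_eq_toFinset_card, smul_eq_mul] at h
  omega

/-- Edge and vertex counts add up over a component and its complement. -/
lemma edgeComponent_ncard_add (Y : Set (Sym2 α)) (e : Sym2 α) :
    (edgeComponent Y e).ncard + (Y \ edgeComponent Y e).ncard = Y.ncard ∧
    (edgeVerts (edgeComponent Y e)).ncard + (edgeVerts (Y \ edgeComponent Y e)).ncard
      = (edgeVerts Y).ncard := by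
  refine ⟨?_, ?_⟩
  · rw [add_comm, ncard_sdiff_add_ncard_of_subset (edgeComponent_subset Y e)]
  · rw [← ncard_union_eq (disjoint_edgeVerts_edgeComponent Y e), ← edgeVerts_union,
      union_sdiff_cancel (edgeComponent_subset Y e)]

lemma ncard_edgeVerts_submodular (X Y : Set (Sym2 α)) :
    (edgeVerts (X ∪ Y)).ncard + (edgeVerts X ∩ edgeVerts Y).ncard
      = (edgeVerts X).ncard + (edgeVerts Y).ncard := by
  rw [edgeVerts_union, ncard_union_add_ncard_inter]

/-- Removing the only edge at a vertex loses that vertex. -/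
lemma exists_ncard_edgeVerts_lt {x : α} (hx : x ∈ edgeVerts Y)
    (hdeg : ({e ∈ Y | x ∈ e}).ncard < 2) :
    ∃ e ∈ Y, (edgeVerts (Y \ {e})).ncard < (edgeVerts Y).ncard := by
  obtain ⟨e, he, hxe⟩ := hx
  refine ⟨e, he, ncard_lt_ncard ⟨edgeVerts_mono sdiff_subset, fun h => ?_⟩⟩
  obtain ⟨f, hf, hxf⟩ := h ⟨e, he, hxe⟩
  have : ({e, f} : Set (Sym2 α)).ncard ≤ ({e ∈ Y | x ∈ e}).ncard := by
    refine ncard_le_ncard ?_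
    rintro g (rfl | rfl)
    exacts [⟨he, hxe⟩, ⟨hf.1, hxf⟩]
  rw [ncard_pair (fun h => hf.2 h.symm)] at this
  omega

lemma two_le_ncard_edgeVerts (hY : ∀ e ∈ Y, ¬ e.IsDiag) (hne : Y.Nonempty) :
    2 ≤ (edgeVerts Y).ncard := by
  obtain ⟨e, he⟩ := hne
  have hd := hY e he
  induction e using Sym2.ind with
  | _ a b =>
    rw [← ncard_pair (a := a) (b := b) (by simpa using hd)]
    refine ncard_le_ncard ?_
    rintro g (rfl | rfl)
    exacts [⟨_, he, Sym2.mem_mk_left _ _⟩, ⟨_, he, Sym2.mem_mk_right _ _⟩]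

/-- A nonempty loopless edge set with at least as many edges as vertices contains a cycle. -/
lemma exists_isCycleSet (hY : ∀ e ∈ Y, ¬ e.IsDiag) (hne : Y.Nonempty)
    (hcard : (edgeVerts Y).ncard ≤ Y.ncard) : ∃ C ⊆ Y, IsCycleSet C := by
  obtain ⟨Z, hZY, hmin⟩ := exists_minimal_le_of_wellFoundedLT
    (fun Z : Set (Sym2 α) => Z ⊆ Y ∧ Z.Nonempty ∧ (edgeVerts Z).ncard ≤ Z.ncard) Y
    ⟨Subset.rfl, hne, hcard⟩
  obtain ⟨-, hZne, hZcard⟩ := hmin.prop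
  have hZ : ∀ e ∈ Z, ¬ e.IsDiag := fun e he => hY e (hZY he)
  have key : ∀ W, W ⊂ Z → W.Nonempty → W.ncard < (edgeVerts W).ncard := by
    intro W hW hWne
    by_contra! h
    exact hW.2 (hmin.le_of_le ⟨hW.1.trans hZY, hWne, h⟩ hW.1)
  have htwo := two_le_ncard_edgeVerts hZ hZne
  have hdel : ∀ e ∈ Z, Z.ncard ≤ (edgeVerts (Z \ {e})).ncard := by
    intro e he
    have h1 := ncard_sdiff_singleton_add_one he
    have := key (Z \ {e}) (by simpa using he) (nonempty_of_ncard_ne_zero (by omega))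
    omega
  have hdeg : ∀ x ∈ edgeVerts Z, 2 ≤ ({e ∈ Z | x ∈ e}).ncard := by
    intro x hx
    by_contra! h
    obtain ⟨e, he, hlt⟩ := exists_ncard_edgeVerts_lt hx h
    have := hdel e he
    omega
  have heq : Z.ncard = (edgeVerts Z).ncard := by
    obtain ⟨e, he⟩ := hZne
    have h1 := hdel e he
    have h2 := ncard_le_ncard (edgeVerts_mono (sdiff_subset : Z \ {e} ⊆ Z))
    omega
  refine ⟨Z, hZY, hZne, fun e he f hf => ?_, ncard_incident_eq_two_of_ge hZ heq hdeg⟩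
  by_contra hef
  have hfK : f ∈ Z \ edgeComponent Z e := ⟨hf, fun h => hef h.2⟩
  have heK : e ∈ edgeComponent Z e := ⟨he, .refl⟩
  have h1 := key (edgeComponent Z e)
    ⟨edgeComponent_subset Z e, fun h => hfK.2 (h hf)⟩ ⟨e, heK⟩
  have h2 := key (Z \ edgeComponent Z e) ⟨sdiff_subset, fun h => (h he).2 heK⟩ ⟨f, hfK⟩
  have h3 := edgeComponent_ncard_add Z e
  omega

lemma BicircIndep.ncard_le (hX : ∀ e ∈ X, ¬ e.IsDiag) (hI : BicircIndep X) :
    X.ncard ≤ (edgeVerts X).ncard := by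
  by_contra! hcard
  obtain ⟨Z, hZX, hmin⟩ := exists_minimal_le_of_wellFoundedLT
    (fun Z : Set (Sym2 α) => Z ⊆ X ∧ (edgeVerts Z).ncard < Z.ncard) X ⟨Subset.rfl, hcard⟩
  have hZcard := hmin.prop.2
  have hZ : ∀ e ∈ Z, ¬ e.IsDiag := fun e he => hX e (hZX he)
  have key : ∀ W, W ⊂ Z → W.ncard ≤ (edgeVerts W).ncard := by
    intro W hW
    by_contra! h
    exact hW.2 (hmin.le_of_le ⟨hW.1.trans hZX, h⟩ hW.1)
  have hZne : Z.Nonempty := nonempty_of_ncard_ne_zero (by omega)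
  have htwo := two_le_ncard_edgeVerts hZ hZne
  obtain ⟨C, hCZ, hC⟩ := exists_isCycleSet hZ hZne hZcard.le
  obtain ⟨e, he⟩ := hC.1
  have h1 := ncard_sdiff_singleton_add_one (hCZ he)
  have h2 := ncard_le_ncard (edgeVerts_mono (sdiff_subset : Z \ {e} ⊆ Z))
  obtain ⟨D, hDZ, hD⟩ := exists_isCycleSet (Y := Z \ {e}) (fun f hf => hZ f hf.1)
    (nonempty_of_ncard_ne_zero (by omega)) (by omega)
  have hconn : Z ⊆ edgeComponent X e := by
    refine fun f hf => ⟨hZX hf, ?_⟩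
    by_contra hef
    have hfK : f ∈ Z \ edgeComponent Z e := ⟨hf, fun h => hef (h.2.mono hZX)⟩
    have heK : e ∈ edgeComponent Z e := ⟨hCZ he, .refl⟩
    have h1 := key (edgeComponent Z e) ⟨edgeComponent_subset Z e, fun h => hfK.2 (h hf)⟩
    have h2 := key (Z \ edgeComponent Z e) ⟨sdiff_subset, fun h => (h (hCZ he)).2 heK⟩
    have h3 := edgeComponent_ncard_add Z e
    omega
  have hCD : C = D := hI e (hZX (hCZ he)) ⟨hCZ.trans hconn, hC⟩
    ⟨(hDZ.trans sdiff_subset).trans hconn, hD⟩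
  exact (hDZ (hCD ▸ he)).2 rfl

/-- A cycle has no proper nonempty subset with equally many edges and vertices. -/
lemma IsCycleSet.eq_of_subset {C D : Set (Sym2 α)} (hloop : ∀ e ∈ C, ¬ e.IsDiag)
    (hC : IsCycleSet C) (hDC : D ⊆ C) (hne : D.Nonempty)
    (hcard : D.ncard = (edgeVerts D).ncard) : D = C := by
  have hle : ∀ x, ({e ∈ D | x ∈ e}) ⊆ {e ∈ C | x ∈ e} := fun x e he => ⟨hDC he.1, he.2⟩
  have hdeg := ncard_incident_eq_two_of_le (fun e he => hloop e (hDC he)) hcard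
    (fun x hx => (ncard_le_ncard (hle x)).trans (hC.2.2 x (edgeVerts_mono hDC hx)).le)
  refine hDC.antisymm fun f hf => ?_
  obtain ⟨e, he⟩ := hne
  have hef := hC.2.1 e (hDC he) f hf
  clear hf
  induction hef with
  | refl => exact he
  | tail _ hstep ih =>
    obtain ⟨-, hb, x, hxa, hxb⟩ := hstep
    have hx : x ∈ edgeVerts D := ⟨_, ih, hxa⟩
    have heq := eq_of_subset_of_ncard_le (hle x)
      (by rw [hdeg x hx, hC.2.2 x (edgeVerts_mono hDC hx)])
    exact (heq.symm.subset ⟨hb, hxb⟩ : _ ∈ {e ∈ D | x ∈ e}).1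

lemma ncard_edgeVerts_insert_le {a b : Sym2 α} {x : α} (ha : a ∈ Y) (hxa : x ∈ a)
    (hxb : x ∈ b) : (edgeVerts (insert b Y)).ncard ≤ (edgeVerts Y).ncard + 1 := by
  obtain ⟨y, rfl⟩ := Sym2.mem_iff_exists.1 hxb
  refine (ncard_le_ncard (t := insert y (edgeVerts Y)) ?_).trans (ncard_insert_le _ _)
  rintro z ⟨e, rfl | he, hz⟩
  · rcases Sym2.mem_iff.1 hz with rfl | rfl
    · exact Or.inr ⟨a, ha, hxa⟩
    · exact Or.inl rfl
  · exact Or.inr ⟨e, he, hz⟩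

lemma bicircIndep_of_ncard_le (hX : ∀ e ∈ X, ¬ e.IsDiag)
    (hall : ∀ Y ⊆ X, Y.ncard ≤ (edgeVerts Y).ncard) : BicircIndep X := by
  rintro e₀ - C ⟨hCX, hC⟩ D ⟨hDX, hD⟩
  have hCX' := hCX.trans (edgeComponent_subset X e₀)
  have hDX' := hDX.trans (edgeComponent_subset X e₀)
  have hloopC : ∀ e ∈ C, ¬ e.IsDiag := fun e he => hX e (hCX' he)
  have hloopD : ∀ e ∈ D, ¬ e.IsDiag := fun e he => hX e (hDX' he)
  have hCc := hC.ncard_eq hloopC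
  have hDc := hD.ncard_eq hloopD
  by_cases hne : (C ∩ D).Nonempty
  · have h1 := ncard_edgeVerts_submodular C D
    have h2 := ncard_le_ncard (edgeVerts_inter_subset C D)
    have h3 := hall (C ∪ D) (union_subset hCX' hDX')
    have h4 := hall (C ∩ D) (inter_subset_left.trans hCX')
    have h5 := ncard_union_add_ncard_inter C D
    have h6 : (C ∩ D).ncard = (edgeVerts (C ∩ D)).ncard := by omega
    rw [← hC.eq_of_subset hloopC inter_subset_left hne h6]
    exact hD.eq_of_subset hloopD inter_subset_right hne h6
  exfalso
  -- A tight set that is edge-disjoint from `D` is also vertex-disjoint from `D`.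
  have hdisj : ∀ Y ⊆ X, Y.ncard = (edgeVerts Y).ncard → Disjoint Y D →
      Disjoint (edgeVerts Y) (edgeVerts D) := by
    intro Y hYX hY hYD
    have h1 := ncard_edgeVerts_submodular Y D
    have h2 := hall (Y ∪ D) (union_subset hYX hDX')
    have h3 := ncard_union_eq hYD
    rw [Set.disjoint_iff_inter_eq_empty, ← ncard_eq_zero]
    omega
  obtain ⟨e, he⟩ := hC.1
  obtain ⟨f, hf⟩ := hD.1
  have hgrow : ∀ g, EdgeConn X e g → ∃ Y ⊆ X, g ∈ Y ∧ Y.ncard = (edgeVerts Y).ncard ∧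
      Disjoint Y D := by
    intro g hg
    induction hg with
    | refl =>
      exact ⟨C, hCX', he, hCc, by
        rwa [Set.disjoint_iff_inter_eq_empty, ← not_nonempty_iff_eq_empty]⟩
    | @tail a b _ hstep ih =>
      obtain ⟨Y, hYX, haY, hY, hYD⟩ := ih
      obtain ⟨-, hb, x, hxa, hxb⟩ := hstep
      by_cases hbY : b ∈ Y
      · exact ⟨Y, hYX, hbY, hY, hYD⟩
      have hbD : b ∉ D := fun hbD =>
        Set.disjoint_left.1 (hdisj Y hYX hY hYD) ⟨a, haY, hxa⟩ ⟨b, hbD, hxb⟩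
      have hsub := insert_subset hb hYX
      refine ⟨insert b Y, hsub, mem_insert _ _, ?_, disjoint_insert_left.2 ⟨hbD, hYD⟩⟩
      have h1 := ncard_edgeVerts_insert_le haY hxa hxb
      have h2 := hall _ hsub
      have h3 := ncard_insert_of_notMem hbY
      omega
  have hsymm : EdgeConn X e e₀ := by
    have : Std.Symm fun a b : Sym2 α => a ∈ X ∧ b ∈ X ∧ ∃ x, x ∈ a ∧ x ∈ b :=
      ⟨fun _ _ ⟨ha, hb, x, hxa, hxb⟩ => ⟨hb, ha, x, hxb, hxa⟩⟩
    exact Relation.ReflTransGen.stdSymm.symm _ _ (hCX he).2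
  obtain ⟨Y, -, hfY, -, hYD⟩ := hgrow f (hsymm.trans (hDX hf).2)
  exact Set.disjoint_left.1 hYD hfY hf

end EdgeSets

section Rank

lemma ncard_le_mrank {β : Type*} [Finite β] {M : Matroid β} {I X : Set β} (hIX : I ⊆ X)
    (hI : M.Indep I) : I.ncard ≤ mrank M X :=
  le_csSup ⟨X.ncard, by rintro _ ⟨J, hJX, -, rfl⟩; exact ncard_le_ncard hJX⟩ ⟨I, hIX, hI, rfl⟩

lemma mrank_le {β : Type*} {M : Matroid β} {X : Set β} {k : ℕ}
    (h : ∀ I ⊆ X, M.Indep I → I.ncard ≤ k) : mrank M X ≤ k :=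
  csSup_le ⟨0, ∅, empty_subset _, M.empty_indep, ncard_empty _⟩
    (by rintro _ ⟨I, hIX, hI, rfl⟩; exact h I hIX hI)

lemma mrank_le_ncard {β : Type*} [Finite β] (M : Matroid β) (X : Set β) :
    mrank M X ≤ X.ncard :=
  mrank_le fun _ hIX _ => ncard_le_ncard hIX

variable {α : Type*} [Fintype α] {G : SimpleGraph α} {M : Matroid (Sym2 α)}

lemma IsBicircular.mrank_le_ncard_edgeVerts (hM : IsBicircular G M) (X : Set (Sym2 α)) :
    mrank M X ≤ (edgeVerts X).ncard := by
  refine mrank_le fun I hIX hI => ?_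
  have hIE : I ⊆ G.edgeSet := hM.1 ▸ hI.subset_ground
  exact (((hM.2 I hIE).1 hI).ncard_le (not_isDiag_of_subset_edgeSet hIE)).trans
    (ncard_le_ncard (edgeVerts_mono hIX))

lemma IsBicircular.indep_iff (hM : IsBicircular G M) {X : Set (Sym2 α)}
    (hX : X ⊆ G.edgeSet) : M.Indep X ↔ ∀ Y ⊆ X, Y.ncard ≤ (edgeVerts Y).ncard := by
  refine ⟨fun h Y hY => ?_, fun h => (hM.2 X hX).2
    (bicircIndep_of_ncard_le (not_isDiag_of_subset_edgeSet hX) h)⟩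
  exact ((hM.2 Y (hY.trans hX)).1 (h.subset hY)).ncard_le
    (not_isDiag_of_subset_edgeSet (hY.trans hX))

/-- The nontrivial half of the rank formula
`r(X) = min {|V(Y)| + |X \ Y| : Y ⊆ X}` for bicircular matroids. -/
lemma IsBicircular.exists_le_mrank (hM : IsBicircular G M) {X : Set (Sym2 α)}
    (hX : X ⊆ G.edgeSet) :
    ∃ Y ⊆ X, (edgeVerts Y).ncard + (X \ Y).ncard ≤ mrank M X := by
  obtain ⟨I, -, hmax⟩ := exists_maximal_ge_of_wellFoundedGT
    (fun I : Set (Sym2 α) => I ⊆ X ∧ M.Indep I) ∅ ⟨empty_subset _, M.empty_indep⟩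
  obtain ⟨hIX, hI⟩ := hmax.prop
  have hall := (hM.indep_iff (hIX.trans hX)).1 hI
  obtain ⟨Z, -, hZmax⟩ := exists_maximal_ge_of_wellFoundedGT
    (fun Z : Set (Sym2 α) => Z ⊆ I ∧ Z.ncard = (edgeVerts Z).ncard) ∅
    ⟨empty_subset _, by simp [edgeVerts]⟩
  obtain ⟨hZI, hZ⟩ := hZmax.prop
  have htight : ∀ W ⊆ I, W.ncard = (edgeVerts W).ncard → W ⊆ Z := by
    intro W hWI hW
    refine subset_union_left.trans (hZmax.le_of_ge ⟨union_subset hWI hZI, ?_⟩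
      (subset_union_right : Z ⊆ W ∪ Z))
    have h1 := ncard_edgeVerts_submodular W Z
    have h2 := ncard_le_ncard (edgeVerts_inter_subset W Z)
    have h3 := hall (W ∪ Z) (union_subset hWI hZI)
    have h4 := hall (W ∩ Z) (inter_subset_left.trans hWI)
    have h5 := ncard_union_add_ncard_inter W Z
    omega
  have hspan : ∀ e ∈ X \ I, ∀ x ∈ e, x ∈ edgeVerts Z := by
    rintro e ⟨heX, heI⟩ x hxe
    have hdep : ¬ M.Indep (insert e I) := fun h =>
      heI (hmax.le_of_ge ⟨insert_subset heX hIX, h⟩ (subset_insert e I) (mem_insert e I))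
    rw [hM.indep_iff ((insert_subset heX hIX).trans hX)] at hdep
    push Not at hdep
    obtain ⟨W, hWI, hW⟩ := hdep
    have heW : e ∈ W := by
      by_contra heW
      exact absurd (hall W ((subset_insert_iff_of_notMem heW).1 hWI)) (by omega)
    have hWI' : W \ {e} ⊆ I := by rwa [sdiff_singleton_subset_iff]
    have h1 := ncard_sdiff_singleton_add_one heW
    have h2 := hall _ hWI'
    have hsub := edgeVerts_mono (sdiff_subset : W \ {e} ⊆ W)
    have h3 := ncard_le_ncard hsub
    have heq := eq_of_subset_of_ncard_le hsub (by omega)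
    exact edgeVerts_mono (htight _ hWI' (by omega)) (heq ▸ ⟨e, heW, hxe⟩)
  refine ⟨Z ∪ X \ I, union_subset (hZI.trans hIX) sdiff_subset, ?_⟩
  have hverts : edgeVerts (Z ∪ X \ I) = edgeVerts Z := by
    rw [edgeVerts_union, union_eq_left]
    rintro x ⟨e, he, hxe⟩
    exact hspan e he x hxe
  have hdiff : X \ (Z ∪ X \ I) = I \ Z := by
    ext e
    simp only [mem_sdiff, mem_union]
    grind
  rw [hverts, hdiff, ← hZ, add_comm, ncard_sdiff_add_ncard_of_subset hZI]
  exact ncard_le_mrank hIX hI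

/-- Apart from a single edge, a 3-connected bicircular matroid has full rank. -/
lemma IsBicircular.card_le_mrank_ground (hM : IsBicircular G M) (hconnG : G.Connected)
    (h3 : ThreeConnected M) (hE : 2 ≤ G.edgeSet.ncard) :
    Nat.card α ≤ mrank M M.E ∧ mrank M M.E < G.edgeSet.ncard := by
  have hlt : mrank M M.E < G.edgeSet.ncard := by
    by_contra! h
    obtain ⟨e, he⟩ := nonempty_of_ncard_ne_zero (s := G.edgeSet) (by omega)
    have h1 := ncard_sdiff_singleton_add_one he
    have h2 := mrank_le_ncard M {e}
    have h4 := mrank_le_ncard M (G.edgeSet \ {e})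
    rw [ncard_singleton] at h2
    refine h3 {e} (by simpa [hM.1] using he) 1 one_pos (by norm_num) ⟨by simp, ?_, ?_⟩
    · rw [hM.1]; omega
    · rw [connVal, hM.1]; rw [hM.1] at h; omega
  refine ⟨?_, hlt⟩
  obtain ⟨Y, hYE, hY⟩ := hM.exists_le_mrank (Subset.refl G.edgeSet)
  have h1 := hM.mrank_le_ncard_edgeVerts Y
  have h2 := mrank_le_ncard M (G.edgeSet \ Y)
  have hYE' : Y ⊆ M.E := hM.1 ▸ hYE
  have h4 := h3 Y hYE' 1 one_pos (by norm_num)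
  have h5 := ncard_sdiff_add_ncard_of_subset hYE
  rw [connVal, hM.1] at h4
  rw [hM.1] at hlt ⊢
  have hcases : Y.ncard = 0 ∨ (G.edgeSet \ Y).ncard = 0 := by omega
  rcases hcases with h | h
  · omega
  · have hYeq : G.edgeSet ⊆ Y := by rwa [ncard_eq_zero, sdiff_eq_empty] at h
    have huniv : edgeVerts Y = univ := by
      refine eq_univ_of_forall fun x => ?_
      have : Nontrivial α := by
        by_contra hα
        rw [not_nontrivial_iff_subsingleton] at hα
        obtain ⟨e, he⟩ := nonempty_of_ncard_ne_zero (s := G.edgeSet) (by omega)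
        induction e using Sym2.ind with
        | _ a b => exact G.ne_of_adj he (Subsingleton.elim a b)
      obtain ⟨y, hy⟩ := hconnG.preconnected.exists_adj_of_nontrivial x
      exact ⟨s(x, y), hYeq hy, Sym2.mem_mk_left x y⟩
    rw [huniv, ncard_univ] at hY
    omega

lemma IsBicircular.three_le_degree (hM : IsBicircular G M) (hconnG : G.Connected)
    (h3 : ThreeConnected M) (hE : 2 ≤ G.edgeSet.ncard) (x : α) :
    3 ≤ ({e ∈ G.edgeSet | x ∈ e}).ncard := by
  classical
  obtain ⟨hrank, hlt⟩ := hM.card_le_mrank_ground hconnG h3 hE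
  by_contra! hdeg
  set S : Set (Sym2 α) := {e ∈ G.edgeSet | x ∈ e}
  have hSE : S ⊆ G.edgeSet := fun e he => he.1
  have h1 := mrank_le_ncard M S
  have h2 := hM.mrank_le_ncard_edgeVerts (G.edgeSet \ S)
  have h4 : (edgeVerts (G.edgeSet \ S)).ncard < Nat.card α := by
    rw [← ncard_univ]
    refine ncard_lt_ncard ((ssubset_univ_iff).2 fun h => ?_)
    obtain ⟨e, he, hxe⟩ := h.symm.subset (mem_univ x)
    exact he.2 ⟨he.1, hxe⟩
  have h5 := ncard_sdiff_add_ncard_of_subset hSE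
  have hcard : G.edgeSet.ncard ≤ (Nat.card α).choose 2 := by
    have := G.card_edgeFinset_le_card_choose_two
    rwa [← SimpleGraph.coe_edgeFinset, ncard_coe_finset, Nat.card_eq_fintype_card]
  have hsep := h3 S (hM.1 ▸ hSE) S.ncard
  rw [connVal, hM.1] at hsep
  rw [hM.1] at hrank hlt
  have hSpos : 0 < S.ncard := by
    rw [ncard_pos, nonempty_iff_ne_empty]
    intro hS0
    rw [hS0, sdiff_empty] at h2 h4
    omega
  have hEcard : G.edgeSet.ncard ≤ 3 := by
    by_contra! h
    exact hsep (by omega) hdeg ⟨le_rfl, by omega, by omega⟩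
  have hn : Nat.card α ≤ 2 := by omega
  have : (Nat.card α).choose 2 ≤ Nat.choose 2 2 := Nat.choose_le_choose 2 hn
  rw [Nat.choose_self] at this
  omega

end Rank

/-- for a 3-connected bicircular matroid B(G) with λ_M(U) ≤ λ, at most
14λ − 12 vertices of G are incident both with an edge of U and with an edge of V. -/
theorem bicircular_boundary_vertices {α : Type*} [Fintype α] (G : SimpleGraph α)
    (hconnG : G.Connected) (M : Matroid (Sym2 α)) (hM : IsBicircular G M)
    (h3 : ThreeConnected M)
    (l : ℕ) (hl : 0 < l) (U V : Set (Sym2 α))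
    (hUV : U ∪ V = G.edgeSet) (hdisj : Disjoint U V)
    (hconn : connVal M U ≤ l) :
    ({x : α | (∃ e ∈ U, x ∈ e) ∧ ∃ e ∈ V, x ∈ e}).ncard ≤ 14 * l - 12 := by
  classical
  set B : Set α := {x : α | (∃ e ∈ U, x ∈ e) ∧ ∃ e ∈ V, x ∈ e} with hB
  clear_value B
  have hUE : U ⊆ G.edgeSet := hUV ▸ subset_union_left
  have hVE : V ⊆ G.edgeSet := hUV ▸ subset_union_right
  have hcard : U.ncard + V.ncard = G.edgeSet.ncard := by rw [← hUV, ncard_union_eq hdisj]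
  by_cases hE : G.edgeSet.ncard < 2
  · have hB0 : B = ∅ := by
      refine eq_empty_of_forall_notMem ?_
      rw [hB]
      rintro x ⟨⟨e, he, -⟩, f, hf, -⟩
      have h1 := (ncard_pos (s := U)).2 ⟨e, he⟩
      have h2 := (ncard_pos (s := V)).2 ⟨f, hf⟩
      omega
    simp [hB0]
  have hdeg := hM.three_le_degree hconnG h3 (not_lt.1 hE)
  have hVeq : M.E \ U = V := by
    rw [hM.1, ← hUV, union_sdiff_left, hdisj.symm.sdiff_eq_left]
  rw [connVal, hVeq] at hconn
  have hn : mrank M M.E ≤ Nat.card α :=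
    (hM.mrank_le_ncard_edgeVerts _).trans (ncard_univ α ▸ ncard_le_ncard (subset_univ _))
  obtain ⟨Y, hYU, hY⟩ := hM.exists_le_mrank hUE
  obtain ⟨Z, hZV, hZ⟩ := hM.exists_le_mrank hVE
  set F : Set (Sym2 α) := U \ Y ∪ V \ Z
  have hFE : F ⊆ G.edgeSet :=
    union_subset (sdiff_subset.trans hUE) (sdiff_subset.trans hVE)
  have hFcard : F.ncard = (U \ Y).ncard + (V \ Z).ncard :=
    ncard_union_eq (hdisj.mono sdiff_subset sdiff_subset)
  have hFsum := sum_ncard_incident (not_isDiag_of_subset_edgeSet hFE)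
  have hind : ∀ S : Set α, ∑ x : α, (if x ∈ S then 1 else 0) = S.ncard := by
    intro S
    rw [Finset.sum_boole, ncard_eq_toFinset_card', Nat.cast_id]
    congr 1
    ext x
    simp
  have hpoint : ∀ x : α, 2 + (if x ∈ B then 1 else 0) ≤
      2 * (if x ∈ edgeVerts Y then 1 else 0) + 2 * (if x ∈ edgeVerts Z then 1 else 0)
        + ({e ∈ F | x ∈ e}).ncard := by
    intro x
    by_cases hxY : x ∈ edgeVerts Y <;> by_cases hxZ : x ∈ edgeVerts Z
    · simp only [hxY, hxZ, if_true]
      split_ifs <;> omega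
    · simp only [hxY, hxZ, if_true, if_false]
      split_ifs with hxB
      · rw [hB] at hxB
        obtain ⟨-, e, he, hxe⟩ := hxB
        have : 0 < ({e ∈ F | x ∈ e}).ncard :=
          (ncard_pos).2 ⟨e, Or.inr ⟨he, fun h => hxZ ⟨e, h, hxe⟩⟩, hxe⟩
        omega
      · omega
    · simp only [hxY, hxZ, if_true, if_false]
      split_ifs with hxB
      · rw [hB] at hxB
        obtain ⟨⟨e, he, hxe⟩, -⟩ := hxB
        have : 0 < ({e ∈ F | x ∈ e}).ncard :=
          (ncard_pos).2 ⟨e, Or.inl ⟨he, fun h => hxY ⟨e, h, hxe⟩⟩, hxe⟩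
        omega
      · omega
    · have hall : ({e ∈ G.edgeSet | x ∈ e}) ⊆ {e ∈ F | x ∈ e} := by
        rintro e ⟨he, hxe⟩
        rw [← hUV] at he
        exact ⟨he.imp (fun h => ⟨h, fun h' => hxY ⟨e, h', hxe⟩⟩)
          (fun h => ⟨h, fun h' => hxZ ⟨e, h', hxe⟩⟩), hxe⟩
      have h1 := (hdeg x).trans (ncard_le_ncard hall)
      split_ifs <;> omega
  have hsum := Finset.sum_le_sum fun x (_ : x ∈ Finset.univ) => hpoint x
  simp only [Finset.sum_add_distrib, ← Finset.mul_sum, hind, hFsum, Finset.sum_const,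
    Finset.card_univ, smul_eq_mul, ← Nat.card_eq_fintype_card] at hsum
  omega
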